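/- arXiv:1510.02848 — 3 statements merged into one kernel-verified Lean document; each statement's English description precedes it below -/
import Mathlib

section
/- Assume G and the subgraph G_I induced on the interior nodes are connected. Let γ ∈ ℂ_0^E and let ζ ∈ ℝ be such that the Dirichlet problem for (γ,q) is well-posed for every q ∈ ℂ_ζ^I. If Q(p_1,p_2) = ℂ^I for some p_1, p_2 ∈ ℂ_ζ^I, then every equivalence class of Schrödinger potentials in ℂ_ζ^I for the equivalence relation Λ_{γ,q_1} = Λ_{γ,q_2} has Lebesgue measure zero in ℂ^I; that is, for every q_0 ∈ ℂ_ζ^I, the set {q ∈ ℂ_ζ^I : Λ_{γ,q} = Λ_{γ,q_0}} has Lebesgue measure zero. -/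
/-!
Common setup: a finite graph whose vertex set is partitioned into boundary
nodes `B` and interior nodes `I` (so the vertex set is `B ⊕ I`), with edge
set `E` and a fixed orientation given by maps `head tail : E → B ⊕ I`.
-/

open Matrix MeasureTheory

namespace DIP

noncomputable section

variable {B I E : Type*} [Fintype B] [Fintype I] [Fintype E]
  [DecidableEq B] [DecidableEq I] [DecidableEq E]

/-- Discrete gradient: `(∇u)(e) = u(head e) - u(tail e)`. -/
def grad (head tail : E → B ⊕ I) (u : B ⊕ I → ℂ) : E → ℂ :=
  fun e => u (head e) - u (tail e)

/-- Signed incidence matrix over a commutative ring `α`. -/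
def incMat (α : Type*) [CommRing α] (head tail : E → B ⊕ I) : Matrix E (B ⊕ I) α :=
  Matrix.of fun e v => (if v = head e then (1 : α) else 0) - (if v = tail e then (1 : α) else 0)

/-- Weighted graph Laplacian `L_γ = ∇ᵀ diag(γ) ∇`. -/
def lap (α : Type*) [CommRing α] (head tail : E → B ⊕ I) (γ : E → α) :
    Matrix (B ⊕ I) (B ⊕ I) α :=
  (incMat α head tail)ᵀ * Matrix.diagonal γ * incMat α head tail

/-- The `II` block of the weighted graph Laplacian. -/
def lapII (α : Type*) [CommRing α] (head tail : E → B ⊕ I) (γ : E → α) : Matrix I I α :=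
  (lap α head tail γ).submatrix Sum.inr Sum.inr

/-- The `IB` block of the weighted graph Laplacian. -/
def lapIB (α : Type*) [CommRing α] (head tail : E → B ⊕ I) (γ : E → α) : Matrix I B α :=
  (lap α head tail γ).submatrix Sum.inr Sum.inl

/-- The `BI` block of the weighted graph Laplacian. -/
def lapBI (α : Type*) [CommRing α] (head tail : E → B ⊕ I) (γ : E → α) : Matrix B I α :=
  (lap α head tail γ).submatrix Sum.inl Sum.inr

/-- The `BB` block of the weighted graph Laplacian. -/
def lapBB (α : Type*) [CommRing α] (head tail : E → B ⊕ I) (γ : E → α) : Matrix B B α :=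
  (lap α head tail γ).submatrix Sum.inl Sum.inl

/-- Dirichlet-to-Neumann map
`Λ_{γ,q} = (L_γ)_BB - (L_γ)_BI [(L_γ)_II + diag(q)]⁻¹ (L_γ)_IB`. -/
def dtn (head tail : E → B ⊕ I) (γ : E → ℂ) (q : I → ℂ) : Matrix B B ℂ :=
  lapBB ℂ head tail γ -
    lapBI ℂ head tail γ * (lapII ℂ head tail γ + Matrix.diagonal q)⁻¹ * lapIB ℂ head tail γ

/-- `u` is `(γ,q)`-harmonic: `(L_γ u)_I + q ⊙ u_I = 0`. -/
def Harmonic (head tail : E → B ⊕ I) (γ : E → ℂ) (q : I → ℂ) (u : B ⊕ I → ℂ) : Prop :=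
  ∀ i : I, (lap ℂ head tail γ).mulVec u (Sum.inr i) + q i * u (Sum.inr i) = 0

/-- The graph `G` is connected. -/
def Gconn (head tail : E → B ⊕ I) : Prop :=
  (SimpleGraph.fromRel fun v w : B ⊕ I => ∃ e, head e = v ∧ tail e = w).Connected

/-- The subgraph of `G` induced on the interior nodes is connected. -/
def GIconn (head tail : E → B ⊕ I) : Prop :=
  (SimpleGraph.fromRel fun i j : I => ∃ e, head e = Sum.inr i ∧ tail e = Sum.inr j).Connected

/-- `P(γ₁,γ₂)`: span of Hadamard products of gradients of harmonic functions. -/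
def Pspace (head tail : E → B ⊕ I) (γ₁ γ₂ : E → ℂ) : Submodule ℂ (E → ℂ) :=
  Submodule.span ℂ { w : E → ℂ | ∃ u v : B ⊕ I → ℂ,
    Harmonic head tail γ₁ 0 u ∧ Harmonic head tail γ₂ 0 v ∧
    w = fun e => grad head tail u e * grad head tail v e }

/-- `Q(q₁,q₂)`: span of Hadamard products of interior values of harmonic functions. -/
def Qspace (head tail : E → B ⊕ I) (γ : E → ℂ) (q₁ q₂ : I → ℂ) : Submodule ℂ (I → ℂ) :=
  Submodule.span ℂ { w : I → ℂ | ∃ u v : B ⊕ I → ℂ,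
    Harmonic head tail γ q₁ u ∧ Harmonic head tail γ q₂ v ∧
    w = fun i => u (Sum.inr i) * v (Sum.inr i) }

/-- The matrix `U(γ)` whose `i`-th column is the harmonic extension of the
standard basis vector `e_i ∈ ℂ^B`. -/
def Usol (head tail : E → B ⊕ I) (γ : E → ℂ) : Matrix (B ⊕ I) B ℂ :=
  Matrix.of (Sum.elim (fun b i => if b = i then (1 : ℂ) else 0)
    (fun j i => (-((lapII ℂ head tail γ)⁻¹ * lapIB ℂ head tail γ)) j i))

/-- The products-of-gradients matrix `F(γ₁,γ₂) ∈ ℂ^{|E| × |B|²}` whose column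
indexed by `(i,j)` is `(∇ U(γ₁))_{:,i} ⊙ (∇ U(γ₂))_{:,j}`. -/
def Fmat (head tail : E → B ⊕ I) (γ₁ γ₂ : E → ℂ) : Matrix E (B × B) ℂ :=
  Matrix.of fun e p =>
    grad head tail (fun v => Usol head tail γ₁ v p.1) e *
    grad head tail (fun v => Usol head tail γ₂ v p.2) e

/-- Smallest eigenvalue of a real symmetric matrix, as the minimum of its
Rayleigh quotient over the (Euclidean) unit sphere. -/
def lambdaMin (M : Matrix I I ℝ) : ℝ :=
  ⨅ x : { x : I → ℝ // ∑ i, x i ^ 2 = 1 }, (x : I → ℝ) ⬝ᵥ M.mulVec (x : I → ℝ)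


theorem poly_null_fin : ∀ (n : ℕ) (P : MvPolynomial (Fin n) ℂ), P ≠ 0 →
    volume {x : Fin n → ℂ | MvPolynomial.eval x P = 0} = 0 := by
  intro n
  induction n with
  | zero =>
    intro P hP
    have : {x : Fin 0 → ℂ | MvPolynomial.eval x P = 0} = ∅ := by
      ext x
      simp only [Set.mem_setOf_eq, Set.mem_empty_iff_false, iff_false]
      intro h
      apply hP
      apply MvPolynomial.funext
      intro y
      rw [Subsingleton.elim y x, h, map_zero]
    rw [this, measure_empty]
  | succ n ih =>
    intro P hP
    set F := MvPolynomial.finSuccEquiv ℂ n P with hF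
    have hF0 : F ≠ 0 := by
      intro h
      exact hP ((MvPolynomial.finSuccEquiv ℂ n).injective (by rw [← hF, h, map_zero]))
    obtain ⟨k, hk⟩ : ∃ k, F.coeff k ≠ 0 := by
      by_contra! h
      exact hF0 (Polynomial.ext (by simpa using h))
    have hmp := (volume_preserving_piFinSuccAbove (fun _ : Fin (n+1) => ℂ) 0)
    have hsw : MeasurePreserving (Prod.swap : ℂ × (Fin n → ℂ) → (Fin n → ℂ) × ℂ) volume volume :=
      Measure.measurePreserving_swap
    have hcomp := hsw.comp hmp
    set Z : Set ((Fin n → ℂ) × ℂ) := {z | MvPolynomial.eval (Fin.cons z.2 z.1 : Fin (n+1) → ℂ) P = 0} with hZ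
    have hcont : Continuous fun z : (Fin n → ℂ) × ℂ =>
        MvPolynomial.eval (Fin.cons z.2 z.1 : Fin (n+1) → ℂ) P := by
      apply (MvPolynomial.continuous_eval P).comp
      refine continuous_pi fun i => ?_
      refine Fin.cases ?_ (fun j => ?_) i
      · simpa using continuous_snd
      · simpa using (show Continuous fun z : (Fin n → ℂ) × ℂ => z.1 j by fun_prop)
    have hZm : MeasurableSet Z := (isClosed_singleton.preimage hcont).measurableSet
    have hZ0 : volume Z = 0 := by
      rw [Measure.volume_eq_prod, Measure.measure_prod_null hZm]
      have h1 : ∀ᵐ s : Fin n → ℂ, MvPolynomial.eval s (F.coeff k) ≠ 0 := by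
        rw [ae_iff]
        simpa using ih _ hk
      filter_upwards [h1] with s hs
      have hne : F.map (MvPolynomial.eval s) ≠ 0 := by
        intro h
        apply hs
        have := congrArg (fun p => Polynomial.coeff p k) h
        simpa using this
      apply Set.Finite.measure_zero
      refine (Polynomial.finite_setOf_isRoot hne).subset ?_
      intro y hy
      have : MvPolynomial.eval (Fin.cons y s : Fin (n+1) → ℂ) P = 0 := hy
      rw [MvPolynomial.eval_eq_eval_mv_eval'] at this
      exact this
    have := hcomp.measure_preimage hZm.nullMeasurableSet
    rw [hZ0] at this
    rw [← this]
    congr 1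
    ext x
    simp only [hZ, Set.mem_setOf_eq, Set.mem_preimage, Function.comp]
    have hx : (Fin.cons (x 0) (Fin.tail x) : Fin (n+1) → ℂ) = x := Fin.cons_self_tail x
    conv_lhs => rw [← hx]
    rfl

theorem poly_null {I : Type*} [Fintype I] (P : MvPolynomial I ℂ) (hP : P ≠ 0) :
    volume {x : I → ℂ | MvPolynomial.eval x P = 0} = 0 := by
  let e := Fintype.equivFin I
  have h := poly_null_fin _ (MvPolynomial.rename e P) (by
    intro h
    exact hP (MvPolynomial.rename_injective e e.injective (by rw [h, map_zero])))
  have hm := (volume_measurePreserving_piCongrLeft (fun _ : Fin (Fintype.card I) => ℂ) e)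
  have hms : MeasurableSet {x : Fin (Fintype.card I) → ℂ |
      MvPolynomial.eval x (MvPolynomial.rename e P) = 0} :=
    (isClosed_singleton.preimage (MvPolynomial.continuous_eval _)).measurableSet
  have := hm.measure_preimage hms.nullMeasurableSet
  rw [h] at this
  rw [← this]
  congr 1
  ext x
  simp only [Set.mem_setOf_eq, Set.mem_preimage, MvPolynomial.eval_rename]
  have : (MeasurableEquiv.piCongrLeft (fun _ : Fin (Fintype.card I) => ℂ) e) x ∘ e = x := by
    funext i
    exact Equiv.piCongrLeft_apply_apply (fun _ : Fin (Fintype.card I) => ℂ) e x i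
  rw [this]

theorem lap_symm (head tail : E → B ⊕ I) (γ : E → ℂ) :
    (lap ℂ head tail γ)ᵀ = lap ℂ head tail γ := by
  simp [lap, Matrix.transpose_mul, Matrix.mul_assoc]

theorem lapBI_eq (head tail : E → B ⊕ I) (γ : E → ℂ) :
    lapBI ℂ head tail γ = (lapIB ℂ head tail γ)ᵀ := by
  rw [lapBI, lapIB, ← lap_symm, Matrix.transpose_submatrix, Matrix.transpose_transpose, lap_symm]

theorem harm_iff (head tail : E → B ⊕ I) (γ : E → ℂ) (q : I → ℂ) (u : B ⊕ I → ℂ)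
    (h : Harmonic head tail γ q u) :
    (lapII ℂ head tail γ + Matrix.diagonal q).mulVec (fun i => u (Sum.inr i)) =
      - (lapIB ℂ head tail γ).mulVec (fun b => u (Sum.inl b)) := by
  funext i
  have := h i
  simp only [Matrix.mulVec, dotProduct, Fintype.sum_sum_type] at this
  simp only [Matrix.add_mulVec, Pi.add_apply, Pi.neg_apply, Matrix.mulVec_diagonal]
  simp only [Matrix.mulVec, dotProduct, lapII, lapIB, Matrix.submatrix_apply]
  linear_combination this

theorem key (A : Matrix I I ℂ) (hA : Aᵀ = A) (g x x' : I → ℂ) (i : I) (q : I → ℂ)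
    (hu : IsUnit (A + Matrix.diagonal q))
    (h1 : (A + Matrix.diagonal q).mulVec x = g)
    (h2 : (A + Matrix.diagonal (q + Pi.single i 1)).mulVec x' = g)
    (h3 : g ⬝ᵥ x = g ⬝ᵥ x') : x i = 0 := by
  set M := A + Matrix.diagonal q with hM
  have hMt : Mᵀ = M := by simp [hM, hA]
  have h2' : M.mulVec x' + Pi.single i (x' i) = g := by
    rw [← h2, hM]
    funext j
    by_cases hj : j = i
    · subst hj
      simp [Matrix.add_mulVec, Matrix.mulVec_diagonal]; ring
    · simp [Matrix.add_mulVec, Matrix.mulVec_diagonal, hj]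
  have h4 : M.mulVec x ⬝ᵥ x' = M.mulVec x' ⬝ᵥ x := by
    rw [dotProduct_comm, Matrix.dotProduct_mulVec, ← Matrix.mulVec_transpose, hMt]
  have h5 : x' i * x i = 0 := by
    have e1 : g ⬝ᵥ x = M.mulVec x' ⬝ᵥ x + x' i * x i := by
      rw [← h2', add_dotProduct, single_dotProduct]
    have e2 : g ⬝ᵥ x' = M.mulVec x ⬝ᵥ x' := by rw [h1]
    rw [e1, e2, h4] at h3
    simpa using h3
  rcases mul_eq_zero.1 h5 with h | h
  · rw [h, Pi.single_zero, add_zero, ← h1] at h2'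
    have := Matrix.mulVec_injective_of_isUnit hu h2'
    rw [← this, h]
  · exact h

/-- Numerator polynomial. -/
def numP (A : Matrix I I ℂ) (R : Matrix I B ℂ) (K : Matrix B B ℂ) (b c : B) :
    MvPolynomial I ℂ :=
  (((R.transpose.map MvPolynomial.C : Matrix B I (MvPolynomial I ℂ)) *
    (A.map MvPolynomial.C + Matrix.diagonal MvPolynomial.X : Matrix I I (MvPolynomial I ℂ)).adjugate *
      (R.map MvPolynomial.C : Matrix I B (MvPolynomial I ℂ)) : Matrix B B (MvPolynomial I ℂ)) b c)
  - (A.map MvPolynomial.C + Matrix.diagonal MvPolynomial.X).det * MvPolynomial.C (K b c)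

theorem eval_numP (A : Matrix I I ℂ) (R : Matrix I B ℂ) (K : Matrix B B ℂ) (b c : B)
    (q : I → ℂ) : MvPolynomial.eval q (numP A R K b c) =
      (Rᵀ * (A + Matrix.diagonal q).adjugate * R) b c - (A + Matrix.diagonal q).det * K b c := by
  have hm : (MvPolynomial.eval q).mapMatrix
      (A.map MvPolynomial.C + Matrix.diagonal MvPolynomial.X) = A + Matrix.diagonal q := by
    ext i j
    by_cases h : i = j
    · subst h; simp
    · simp [h]
  have hadj := RingHom.map_adjugate (MvPolynomial.eval q)
    (A.map MvPolynomial.C + Matrix.diagonal MvPolynomial.X)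
  have hdet := RingHom.map_det (MvPolynomial.eval q)
    (A.map MvPolynomial.C + Matrix.diagonal MvPolynomial.X)
  rw [hm] at hadj hdet
  rw [numP, map_sub, map_mul, hdet, MvPolynomial.eval_C, ← hadj]
  simp [Matrix.mul_apply]

theorem eval_numP_eq_zero_iff (A : Matrix I I ℂ) (R : Matrix I B ℂ) (K : Matrix B B ℂ)
    (q : I → ℂ) (hu : IsUnit (A + Matrix.diagonal q)) :
    (∀ b c, MvPolynomial.eval q (numP A R K b c) = 0) ↔
      Rᵀ * (A + Matrix.diagonal q)⁻¹ * R = K := by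
  have hd : (A + Matrix.diagonal q).det ≠ 0 := ((Matrix.isUnit_iff_isUnit_det _).1 hu).ne_zero
  have : ∀ b c, (Rᵀ * (A + Matrix.diagonal q)⁻¹ * R) b c =
      (A + Matrix.diagonal q).det⁻¹ * (Rᵀ * (A + Matrix.diagonal q).adjugate * R) b c := by
    intro b c
    rw [Matrix.inv_def, Ring.inverse_eq_inv', Matrix.mul_smul, Matrix.smul_mul]
    rfl
  constructor
  · intro h
    ext b c
    have h' := h b c
    rw [eval_numP] at h'
    rw [this, sub_eq_zero.1 h']
    field_simp
  · intro h b c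
    rw [eval_numP, ← h, this]
    field_simp
    ring

/-- if the `(γ,q)` Dirichlet problem is well-posed for all
`q ∈ ℂ_ζ^I` and `Q(p₁,p₂) = ℂ^I` for some `p₁,p₂ ∈ ℂ_ζ^I`, then every
equivalence class for `Λ_{γ,q₁} = Λ_{γ,q₂}` has Lebesgue measure zero in `ℂ^I`. -/
theorem equiv_class_measure_zero_schroe [Nonempty B] (head tail : E → B ⊕ I)
    (hG : Gconn head tail) (hGI : GIconn head tail)
    (γ : E → ℂ) (hγ : ∀ e, 0 < (γ e).re) (ζ : ℝ)
    (hwell : ∀ q : I → ℂ, (∀ i, ζ < (q i).re) →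
      IsUnit (lapII ℂ head tail γ + Matrix.diagonal q))
    (p₁ p₂ : I → ℂ) (hp₁ : ∀ i, ζ < (p₁ i).re) (hp₂ : ∀ i, ζ < (p₂ i).re)
    (hQ : Qspace head tail γ p₁ p₂ = ⊤)
    (q₀ : I → ℂ) (hq₀ : ∀ i, ζ < (q₀ i).re) :
    volume { q : I → ℂ | (∀ i, ζ < (q i).re) ∧
      dtn head tail γ q = dtn head tail γ q₀ } = 0 := by
  set A := lapII ℂ head tail γ with hAdef
  set R := lapIB ℂ head tail γ with hRdef
  have hA : Aᵀ = A := by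
    rw [hAdef, lapII, Matrix.transpose_submatrix, lap_symm]
  have hdtn : ∀ q : I → ℂ, dtn head tail γ q =
      lapBB ℂ head tail γ - Rᵀ * (A + Matrix.diagonal q)⁻¹ * R := by
    intro q
    rw [dtn, lapBI_eq]
  set K := Rᵀ * (A + Matrix.diagonal q₀)⁻¹ * R with hK
  have hiff : ∀ q : I → ℂ, (∀ i, ζ < (q i).re) → (dtn head tail γ q = dtn head tail γ q₀ ↔
      ∀ b c, MvPolynomial.eval q (numP A R K b c) = 0) := by
    intro q hq
    rw [eval_numP_eq_zero_iff A R K q (hwell q hq), hdtn, hdtn, sub_right_inj]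
  by_cases hall : ∀ b c, numP A R K b c = 0
  · exfalso
    have hconst : ∀ q : I → ℂ, (∀ i, ζ < (q i).re) → Rᵀ * (A + Matrix.diagonal q)⁻¹ * R = K := by
      intro q hq
      rw [← eval_numP_eq_zero_iff A R K q (hwell q hq)]
      intro b c
      rw [hall b c, map_zero]
    have hz : ∀ u, Harmonic head tail γ p₁ u → ∀ i, u (Sum.inr i) = 0 := by
      intro u hu i
      have hq : ∀ j, ζ < ((p₁ + Pi.single i 1 : I → ℂ) j).re := by
        intro j
        by_cases hj : j = i
        · subst hj
          have := hp₁ j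
          simp; linarith
        · simpa [hj] using hp₁ j
      set f : B → ℂ := fun b => - u (Sum.inl b) with hf
      set g : I → ℂ := R.mulVec f with hg
      have hM1 := hwell p₁ hp₁
      have hM2 := hwell _ hq
      have h1 : (A + Matrix.diagonal p₁).mulVec (fun i => u (Sum.inr i)) = g := by
        rw [harm_iff head tail γ p₁ u hu, hg, ← Matrix.mulVec_neg]
        rfl
      have hx : (fun i => u (Sum.inr i)) = (A + Matrix.diagonal p₁)⁻¹.mulVec g := by
        rw [← h1, Matrix.mulVec_mulVec,
          Matrix.nonsing_inv_mul _ ((Matrix.isUnit_iff_isUnit_det _).1 hM1), Matrix.one_mulVec]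
      have hgen : ∀ N : Matrix I I ℂ, g ⬝ᵥ N.mulVec g = f ⬝ᵥ (Rᵀ * N * R).mulVec f := by
        intro N
        rw [← Matrix.mulVec_mulVec, ← Matrix.mulVec_mulVec, ← hg, Matrix.dotProduct_mulVec f,
          Matrix.vecMul_transpose]
      refine key A hA g _ ((A + Matrix.diagonal (p₁ + Pi.single i 1))⁻¹.mulVec g) i p₁ hM1 h1 ?_ ?_
      · rw [Matrix.mulVec_mulVec,
          Matrix.mul_nonsing_inv _ ((Matrix.isUnit_iff_isUnit_det _).1 hM2), Matrix.one_mulVec]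
      · rw [hx, hgen, hgen, hconst _ hp₁, hconst _ hq]
    obtain ⟨i⟩ : Nonempty I := hGI.nonempty
    have hle : Qspace head tail γ p₁ p₂ ≤ ⊥ := by
      rw [Qspace, Submodule.span_le]
      rintro w ⟨u, v, hu, -, rfl⟩
      have : (fun i => u (Sum.inr i) * v (Sum.inr i)) = (0 : I → ℂ) := by
        funext j
        simp [hz u hu j]
      simp [this]
    have h1 : (1 : I → ℂ) ∈ (⊥ : Submodule ℂ (I → ℂ)) := hle (by rw [hQ]; trivial)
    have := congrFun ((Submodule.mem_bot ℂ).1 h1) i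
    simp at this
  · push Not at hall
    obtain ⟨b, c, hbc⟩ := hall
    refine measure_mono_null ?_ (poly_null _ hbc)
    rintro q ⟨hq, he⟩
    exact (hiff q hq).1 he b c

end

end DIP
end

section
/- Assume G and the subgraph G_I induced on the interior nodes are connected. Let γ ∈ ℂ_0^E and let ζ ∈ ℝ be such that the Dirichlet problem for (γ,q) is well-posed for every q ∈ ℂ_ζ^I. If Q(p,p) = ℂ^I for some p ∈ ℂ_ζ^I (i.e. the linearized inverse Schrödinger problem is solvable at p), then the set of pairs (q_1,q_2) ∈ ℂ_ζ^I × ℂ_ζ^I with Λ_{γ,q_1} = Λ_{γ,q_2} and q_1 ≠ q_2 has Lebesgue measure zero in ℂ^I × ℂ^I; that is, Λ_{γ,q_1} = Λ_{γ,q_2} implies q_1 = q_2 for almost all (q_1,q_2) ∈ ℂ_ζ^I × ℂ_ζ^I. -/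
/-!
Common setup: a finite graph whose vertex set is partitioned into boundary
nodes `B` and interior nodes `I` (so the vertex set is `B ⊕ I`), with edge
set `E` and a fixed orientation given by maps `head tail : E → B ⊕ I`.
-/

open Matrix MeasureTheory

namespace DIP

noncomputable section

variable {B I E : Type*} [Fintype B] [Fintype I] [Fintype E]
  [DecidableEq B] [DecidableEq I] [DecidableEq E]

theorem null_of_rays {F : Type*} [NormedAddCommGroup F] [NormedSpace ℝ F] [MeasurableSpace F]
    [BorelSpace F] [FiniteDimensional ℝ F] (μ : Measure F) [μ.IsAddHaarMeasure] (s : Set F)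
    (hs : MeasurableSet s) (h : ∀ x : F, volume {t : ℝ | t • x ∈ s} = 0) : μ s = 0 := by
  have hm : MeasurableSet {z : F × ℝ | z.2 • z.1 ∈ s} := by
    have : Measurable (fun z : F × ℝ => z.2 • z.1) :=
      (continuous_snd.smul continuous_fst).measurable
    exact this hs
  have h0 : (μ.prod (volume : Measure ℝ)) {z : F × ℝ | z.2 • z.1 ∈ s} = 0 := by
    rw [Measure.measure_prod_null hm]
    exact Filter.Eventually.of_forall fun x => h x
  have h1 : ((volume : Measure ℝ).prod μ) (Prod.swap ⁻¹' {z : F × ℝ | z.2 • z.1 ∈ s}) = 0 := by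
    rw [← Measure.prod_swap, Measure.map_apply measurable_swap (measurable_swap hm)] 
    simpa [Set.preimage_preimage] using h0
  have h2 := Measure.measure_ae_null_of_prod_null h1
  have h3 : ∀ᵐ t : ℝ, t ≠ 0 := by
    simp [ae_iff]
  obtain ⟨t, ht, ht0⟩ := (h2.and h3).exists
  have h4 : μ ((fun x => t • x) ⁻¹' s) = 0 := ht
  rw [Measure.addHaar_preimage_smul μ ht0] at h4
  rcases mul_eq_zero.1 h4 with h5 | h5
  · exfalso
    simp [ht0] at h5
  · exact h5

theorem null_of_poly {F : Type*} [NormedAddCommGroup F] [NormedSpace ℝ F] [MeasurableSpace F]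
    [BorelSpace F] [FiniteDimensional ℝ F] (μ : Measure F) [μ.IsAddHaarMeasure] (f : F → ℂ)
    (hf : Continuous f) (x₀ : F) (h0 : f x₀ ≠ 0)
    (h : ∀ y : F, ∃ P : Polynomial ℂ, ∀ t : ℝ, P.eval (t : ℂ) = f (x₀ + t • y)) :
    μ {x | f x = 0} = 0 := by
  have key : μ ((fun x => x₀ + x) ⁻¹' {x | f x = 0}) = 0 := by
    apply null_of_rays
    · exact (isClosed_singleton.preimage (hf.comp (continuous_const.add continuous_id))).measurableSet
    · intro y
      obtain ⟨P, hP⟩ := h y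
      have hP0 : P ≠ 0 := by
        rintro rfl
        apply h0
        have := hP 0
        simpa using this.symm
      apply Set.Finite.measure_zero
      have hfin : {z : ℂ | P.IsRoot z}.Finite := Polynomial.finite_setOf_isRoot hP0
      refine (hfin.preimage (f := fun t : ℝ => (t : ℂ)) Complex.ofReal_injective.injOn).subset ?_
      intro t ht
      simp only [Set.mem_preimage, Set.mem_setOf_eq, Polynomial.IsRoot] at ht ⊢
      rw [hP, ht]
  rwa [measure_preimage_add] at key

/-- adjugate solution matrix -/
def Wm (head tail : E → B ⊕ I) (γ : E → ℂ) (q : I → ℂ) : Matrix I B ℂ :=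
  (lapII ℂ head tail γ + Matrix.diagonal q).adjugate * lapIB ℂ head tail γ

def Tm (head tail : E → B ⊕ I) (γ : E → ℂ) (σ : I → B × B) (r : (I → ℂ) × (I → ℂ)) :
    Matrix I I ℂ :=
  Matrix.of fun i k => Wm head tail γ r.1 i (σ k).1 * Wm head tail γ r.2 i (σ k).2

theorem Wm_poly (head tail : E → B ⊕ I) (γ : E → ℂ) (q y : I → ℂ) :
    ∃ P : Matrix I B (Polynomial ℂ), ∀ t : ℝ, ∀ i b,
      (P i b).eval (t : ℂ) = Wm head tail γ (q + t • y) i b := by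
  refine ⟨((lapII ℂ head tail γ).map Polynomial.C + Matrix.diagonal (fun i =>
    Polynomial.C (q i) + Polynomial.X * Polynomial.C (y i))).adjugate *
      (lapIB ℂ head tail γ).map Polynomial.C, fun t i b => ?_⟩
  have hA : (Polynomial.evalRingHom (t : ℂ)).mapMatrix
      ((lapII ℂ head tail γ).map Polynomial.C + Matrix.diagonal (fun i =>
        Polynomial.C (q i) + Polynomial.X * Polynomial.C (y i))) =
      lapII ℂ head tail γ + Matrix.diagonal (q + t • y) := by
    ext j k
    by_cases hjk : j = k
    · subst hjk; simp; ring
    · simp [Matrix.diagonal_apply_ne _ hjk]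
  rw [Wm, ← hA, ← RingHom.map_adjugate, Matrix.mul_apply, Matrix.mul_apply,
    Polynomial.eval_finset_sum]
  simp

theorem Tm_poly (head tail : E → B ⊕ I) (γ : E → ℂ) (σ : I → B × B)
    (r y : (I → ℂ) × (I → ℂ)) :
    ∃ P : Polynomial ℂ, ∀ t : ℝ, P.eval (t : ℂ) = (Tm head tail γ σ (r + t • y)).det := by
  obtain ⟨P1, h1⟩ := Wm_poly head tail γ r.1 y.1
  obtain ⟨P2, h2⟩ := Wm_poly head tail γ r.2 y.2
  refine ⟨(Matrix.of fun i k => P1 i (σ k).1 * P2 i (σ k).2 : Matrix I I (Polynomial ℂ)).det,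
    fun t => ?_⟩
  rw [← Polynomial.coe_evalRingHom, RingHom.map_det]
  congr 1
  ext i k
  simp [Tm, h1, h2]

theorem Tm_cont (head tail : E → B ⊕ I) (γ : E → ℂ) (σ : I → B × B) :
    Continuous fun r => (Tm head tail γ σ r).det := by
  have hW : Continuous (Wm head tail γ) := by
    unfold Wm
    exact ((continuous_const.add continuous_id.matrix_diagonal).matrix_adjugate).matrix_mul
      continuous_const
  apply Continuous.matrix_det
  refine continuous_matrix fun i k => ?_
  exact ((hW.comp continuous_fst).matrix_elem _ _).mul ((hW.comp continuous_snd).matrix_elem _ _)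

theorem lapII_symm (head tail : E → B ⊕ I) (γ : E → ℂ) :
    (lapII ℂ head tail γ)ᵀ = lapII ℂ head tail γ := by
  rw [lapII, Matrix.transpose_submatrix, lap_symm]

theorem lapIB_symm (head tail : E → B ⊕ I) (γ : E → ℂ) :
    (lapIB ℂ head tail γ)ᵀ = lapBI ℂ head tail γ := by
  rw [lapIB, Matrix.transpose_submatrix, lap_symm, lapBI]

theorem Wm_eq (head tail : E → B ⊕ I) (γ : E → ℂ) (q : I → ℂ)
    (h : IsUnit (lapII ℂ head tail γ + Matrix.diagonal q)) :
    Wm head tail γ q = (lapII ℂ head tail γ + Matrix.diagonal q).det •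
      ((lapII ℂ head tail γ + Matrix.diagonal q)⁻¹ * lapIB ℂ head tail γ) := by
  have hd := (Matrix.isUnit_iff_isUnit_det _).1 h
  rw [Wm, Matrix.inv_def, Matrix.smul_mul, smul_smul, Ring.mul_inverse_cancel _ hd, one_smul]

theorem aless (head tail : E → B ⊕ I) (γ : E → ℂ) (q₁ q₂ : I → ℂ)
    (h1 : IsUnit (lapII ℂ head tail γ + Matrix.diagonal q₁))
    (h2 : IsUnit (lapII ℂ head tail γ + Matrix.diagonal q₂))
    (h : dtn head tail γ q₁ = dtn head tail γ q₂) :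
    (Wm head tail γ q₁)ᵀ * Matrix.diagonal (q₂ - q₁) * Wm head tail γ q₂ = 0 := by
  have hd1 := (Matrix.isUnit_iff_isUnit_det _).1 h1
  have hd2 := (Matrix.isUnit_iff_isUnit_det _).1 h2
  rw [Wm_eq _ _ _ _ h1, Wm_eq _ _ _ _ h2]
  have hsym : (lapII ℂ head tail γ + Matrix.diagonal q₁)⁻¹ᵀ =
      (lapII ℂ head tail γ + Matrix.diagonal q₁)⁻¹ := by
    rw [Matrix.transpose_nonsing_inv, Matrix.transpose_add, lapII_symm, Matrix.diagonal_transpose]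
  have hD : Matrix.diagonal (q₂ - q₁) = (lapII ℂ head tail γ + Matrix.diagonal q₂) -
      (lapII ℂ head tail γ + Matrix.diagonal q₁) := by
    rw [add_sub_add_left_eq_sub, Matrix.diagonal_sub]; rfl
  unfold dtn at h
  rw [hD, Matrix.transpose_smul, Matrix.transpose_mul, hsym, lapIB_symm]
  generalize lapII ℂ head tail γ + Matrix.diagonal q₁ = A1 at *
  generalize lapII ℂ head tail γ + Matrix.diagonal q₂ = A2 at *
  have h' := sub_right_injective h
  have e : lapBI ℂ head tail γ * A1⁻¹ * (A2 - A1) * (A2⁻¹ * lapIB ℂ head tail γ) = 0 := by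
    have : lapBI ℂ head tail γ * A1⁻¹ * (A2 - A1) * (A2⁻¹ * lapIB ℂ head tail γ)
      = lapBI ℂ head tail γ * (A1⁻¹ * (A2 * A2⁻¹) - (A1⁻¹ * A1) * A2⁻¹) *
        lapIB ℂ head tail γ := by
      simp only [Matrix.mul_sub, Matrix.sub_mul, Matrix.mul_assoc]
    rw [this, Matrix.mul_nonsing_inv _ hd2, Matrix.nonsing_inv_mul _ hd1, Matrix.mul_one,
      Matrix.one_mul, Matrix.mul_sub, Matrix.sub_mul]
    exact sub_eq_zero.2 h'
  rw [Matrix.smul_mul, Matrix.smul_mul, Matrix.mul_smul, e, smul_zero, smul_zero]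

theorem eq_of_det (head tail : E → B ⊕ I) (γ : E → ℂ) (σ : I → B × B) (q₁ q₂ : I → ℂ)
    (h1 : IsUnit (lapII ℂ head tail γ + Matrix.diagonal q₁))
    (h2 : IsUnit (lapII ℂ head tail γ + Matrix.diagonal q₂))
    (h : dtn head tail γ q₁ = dtn head tail γ q₂)
    (hT : (Tm head tail γ σ (q₁, q₂)).det ≠ 0) : q₁ = q₂ := by
  have hz : (q₂ - q₁) = 0 := by
    apply Matrix.eq_zero_of_vecMul_eq_zero hT
    ext k
    have := congrFun (congrFun (aless head tail γ q₁ q₂ h1 h2 h) (σ k).1) (σ k).2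
    rw [Matrix.mul_apply] at this
    simp only [Matrix.mul_diagonal, Matrix.transpose_apply, Matrix.zero_apply] at this
    rw [Pi.zero_apply, ← this]
    simp only [Matrix.vecMul, dotProduct, Tm, Matrix.of_apply]
    exact Finset.sum_congr rfl fun i _ => by ring
  exact (sub_eq_zero.1 hz).symm

theorem harm_eq (head tail : E → B ⊕ I) (γ : E → ℂ) (q : I → ℂ)
    (h : IsUnit (lapII ℂ head tail γ + Matrix.diagonal q)) (u : B ⊕ I → ℂ)
    (hu : Harmonic head tail γ q u) :
    ∃ a : B → ℂ, ∀ i, u (Sum.inr i) = ∑ b, a b * Wm head tail γ q i b := by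
  have hd := (Matrix.isUnit_iff_isUnit_det _).1 h
  set A := lapII ℂ head tail γ + Matrix.diagonal q with hA
  have e1 : A *ᵥ (u ∘ Sum.inr) = - (lapIB ℂ head tail γ *ᵥ (u ∘ Sum.inl)) := by
    ext i
    have := hu i
    simp only [Matrix.mulVec, dotProduct, Fintype.sum_sum_type] at this
    rw [hA, Matrix.add_mulVec, Pi.add_apply, Matrix.mulVec_diagonal, Pi.neg_apply]
    simp only [Matrix.mulVec, dotProduct, lapII, lapIB, Matrix.submatrix_apply, Function.comp]
    linear_combination this
  have e2 : A.det • (u ∘ Sum.inr) = - (Wm head tail γ q *ᵥ (u ∘ Sum.inl)) := by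
    have := congrArg (fun v => A.adjugate *ᵥ v) e1
    simp only [Matrix.mulVec_mulVec, Matrix.adjugate_mul, Matrix.mulVec_neg, Matrix.smul_mulVec,
      Matrix.one_mulVec] at this
    exact this
  refine ⟨fun b => - (A.det⁻¹ * u (Sum.inl b)), fun i => ?_⟩
  have e3 := congrFun e2 i
  simp only [Pi.smul_apply, smul_eq_mul, Function.comp, Pi.neg_apply, Matrix.mulVec,
    dotProduct] at e3
  have e4 : u (Sum.inr i) = A.det⁻¹ * (A.det * u (Sum.inr i)) := by
    rw [← mul_assoc, inv_mul_cancel₀ hd.ne_zero, one_mul]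
  rw [e4, e3, mul_neg, Finset.mul_sum, ← Finset.sum_neg_distrib]
  exact Finset.sum_congr rfl fun b _ => by ring

theorem exists_sigma (head tail : E → B ⊕ I) (γ : E → ℂ) (p : I → ℂ)
    (h : IsUnit (lapII ℂ head tail γ + Matrix.diagonal p))
    (hQ : Qspace head tail γ p p = ⊤) :
    ∃ σ : I → B × B, (Tm head tail γ σ (p, p)).det ≠ 0 := by
  let w : B × B → I → ℂ := fun c i => Wm head tail γ p i c.1 * Wm head tail γ p i c.2
  have hw : Submodule.span ℂ (Set.range w) = ⊤ := by
    rw [eq_top_iff, ← hQ, Qspace, Submodule.span_le]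
    rintro _ ⟨u, v, hu, hv, rfl⟩
    obtain ⟨a, ha⟩ := harm_eq head tail γ p h u hu
    obtain ⟨a', ha'⟩ := harm_eq head tail γ p h v hv
    have : (fun i => u (Sum.inr i) * v (Sum.inr i)) =
        ∑ b, ∑ c, (a b * a' c) • w (b, c) := by
      ext i
      rw [ha, ha', Finset.sum_mul_sum]
      simp only [Finset.sum_apply, Pi.smul_apply, smul_eq_mul, w]
      exact Finset.sum_congr rfl fun b _ => Finset.sum_congr rfl fun c _ => by ring
    rw [this]
    exact Submodule.sum_mem _ fun b _ => Submodule.sum_mem _ fun c _ =>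
      Submodule.smul_mem _ _ (Submodule.subset_span ⟨_, rfl⟩)
  obtain ⟨κ, a, -, hspan, hli⟩ := exists_linearIndependent' ℂ w
  rw [hw] at hspan
  let bs := Module.Basis.mk hli hspan.ge
  let eq := (Pi.basisFun ℂ I).indexEquiv bs
  refine ⟨fun k => a (eq k), ?_⟩
  have hl : LinearIndependent ℂ (Tm head tail γ (fun k => a (eq k)) (p, p)).col :=
    hli.comp eq eq.injective
  exact ((Matrix.isUnit_iff_isUnit_det _).1 (Matrix.linearIndependent_cols_iff_isUnit.1 hl)).ne_zero

/-- if the `(γ,q)` Dirichlet problem is well-posed for all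
`q ∈ ℂ_ζ^I` and `Q(p,p) = ℂ^I` for some `p ∈ ℂ_ζ^I`, then the set of pairs
`(q₁,q₂) ∈ ℂ_ζ^I × ℂ_ζ^I` with `Λ_{γ,q₁} = Λ_{γ,q₂}` and `q₁ ≠ q₂` has
Lebesgue measure zero. -/
theorem dtn_injective_ae_schroe [Nonempty B] (head tail : E → B ⊕ I)
    (hG : Gconn head tail) (hGI : GIconn head tail)
    (γ : E → ℂ) (hγ : ∀ e, 0 < (γ e).re) (ζ : ℝ)
    (hwell : ∀ q : I → ℂ, (∀ i, ζ < (q i).re) →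
      IsUnit (lapII ℂ head tail γ + Matrix.diagonal q))
    (p : I → ℂ) (hp : ∀ i, ζ < (p i).re) (hQ : Qspace head tail γ p p = ⊤) :
    volume { r : (I → ℂ) × (I → ℂ) |
      (∀ i, ζ < (r.1 i).re) ∧ (∀ i, ζ < (r.2 i).re) ∧
        dtn head tail γ r.1 = dtn head tail γ r.2 ∧ r.1 ≠ r.2 } = 0 := by
  obtain ⟨σ, hσ⟩ := exists_sigma head tail γ p (hwell p hp) hQ
  have : (volume : Measure (I → ℂ)).IsAddHaarMeasure :=
    inferInstanceAs ((Measure.pi fun _ : I => (volume : Measure ℂ)).IsAddHaarMeasure)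
  have : (volume : Measure ((I → ℂ) × (I → ℂ))).IsAddHaarMeasure :=
    Measure.prod.instIsAddHaarMeasure (volume : Measure (I → ℂ)) (volume : Measure (I → ℂ))
  refine measure_mono_null (t := {r | (Tm head tail γ σ r).det = 0}) ?_
    (null_of_poly volume _ (Tm_cont head tail γ σ) (p, p) hσ (Tm_poly head tail γ σ (p, p)))
  rintro ⟨q₁, q₂⟩ ⟨h1, h2, h3, h4⟩
  by_contra hne
  exact h4 (eq_of_det head tail γ σ q₁ q₂ (hwell _ h1) (hwell _ h2) h3 hne)

end

end DIP
end

section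
/- Assume G and the subgraph G_I induced on the interior nodes are connected. Let γ ∈ ℂ_0^E and let ζ ∈ ℝ be such that the Dirichlet problem for (γ,q) is well-posed for every q ∈ ℂ_ζ^I. If Q(p,p) = ℂ^I for some p ∈ ℂ_ζ^I, then the set {q ∈ ℂ_ζ^I : Q(q,q) ≠ ℂ^I} has Lebesgue measure zero in ℂ^I; that is, the linearized inverse Schrödinger problem is solvable at almost every q ∈ ℂ_ζ^I. -/
/-!
Common setup: a finite graph whose vertex set is partitioned into boundary
nodes `B` and interior nodes `I` (so the vertex set is `B ⊕ I`), with edge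
set `E` and a fixed orientation given by maps `head tail : E → B ⊕ I`.
-/

open Matrix MeasureTheory

namespace DIP

noncomputable section

variable {B I E : Type*} [Fintype B] [Fintype I] [Fintype E]
  [DecidableEq B] [DecidableEq I] [DecidableEq E]

lemma mvpoly_null (P : MvPolynomial I ℂ) (p : I → ℂ) (hP : MvPolynomial.eval p P ≠ 0) :
    volume {q : I → ℂ | MvPolynomial.eval q P = 0} = 0 := by
  set Z : Set (I → ℂ) := {q : I → ℂ | MvPolynomial.eval q P = 0} with hZ
  have hc : Continuous fun q : I → ℂ => MvPolynomial.eval q P := MvPolynomial.continuous_eval P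
  let S : Set (ℝ × (I → ℂ)) := {x | MvPolynomial.eval (x.1 • x.2 + (p - x.1 • p)) P = 0}
  have hS : MeasurableSet S := by
    have : IsClosed S := isClosed_eq (hc.comp (by fun_prop)) continuous_const
    exact this.measurableSet
  have hsec : ∀ q : I → ℂ, volume {t : ℝ | (t, q) ∈ S} = 0 := by
    intro q
    let R : Polynomial ℂ := MvPolynomial.eval₂ Polynomial.C
      (fun i => Polynomial.X * Polynomial.C (q i) + (Polynomial.C (p i) - Polynomial.X * Polynomial.C (p i))) P
    have hR : ∀ z : ℂ, R.eval z = MvPolynomial.eval (fun i => z * q i + (p i - z * p i)) P := by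
      intro z
      have := MvPolynomial.eval₂_comp_left (Polynomial.evalRingHom z) Polynomial.C
        (fun i => Polynomial.X * Polynomial.C (q i) + (Polynomial.C (p i) - Polynomial.X * Polynomial.C (p i))) P
      rw [Polynomial.coe_evalRingHom] at this
      rw [this, MvPolynomial.eval, MvPolynomial.coe_eval₂Hom]
      congr 1
      · ext <;> simp
      · ext i; simp; ring
    have hR0 : R ≠ 0 := by
      intro h
      apply hP
      have := hR 0
      simpa [h] using this.symm
    have hfin : {t : ℝ | (t, q) ∈ S}.Finite := by
      have h1 : ((fun t : ℝ => (t : ℂ)) ⁻¹' {z | R.IsRoot z}).Finite :=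
        (Polynomial.finite_setOfPred_isRoot hR0).preimage (Complex.ofReal_injective.injOn)
      refine h1.subset ?_
      intro t ht
      show R.eval (t : ℂ) = 0
      rw [hR]
      exact ht
    exact hfin.measure_zero _
  have hprod : (volume : Measure ℝ).prod (volume : Measure (I → ℂ)) S = 0 := by
    rw [Measure.prod_apply_symm hS]
    simp only [lintegral_eq_zero_iff (measurable_measure_prodMk_right hS)]
    exact Filter.Eventually.of_forall hsec
  have h2 := Measure.measure_ae_null_of_prod_null hprod
  have h3 : ∀ᵐ t : ℝ, t ≠ 0 := by
    simp [ae_iff]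
  obtain ⟨t, ht, ht0⟩ := (h2.and h3).exists
  have h4 : Prod.mk t ⁻¹' S = (fun q : I → ℂ => t • q) ⁻¹' ((fun q => q + (p - t • p)) ⁻¹' Z) := rfl
  change volume (Prod.mk t ⁻¹' S) = 0 at ht
  rw [h4, Measure.addHaar_preimage_smul _ ht0, measure_preimage_add_right] at ht
  simpa [ht0] using ht

/-- Polynomial version of the interior operator. -/
def polyA (head tail : E → B ⊕ I) (γ : E → ℂ) : Matrix I I (MvPolynomial I ℂ) :=
  (lapII ℂ head tail γ).map MvPolynomial.C + Matrix.diagonal MvPolynomial.X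

/-- Polynomial (scaled) interior solution. -/
def polyW (head tail : E → B ⊕ I) (γ : E → ℂ) (f : B → ℂ) : I → MvPolynomial I ℂ :=
  -((polyA head tail γ).adjugate *ᵥ (fun i => MvPolynomial.C ((lapIB ℂ head tail γ *ᵥ f) i)))

lemma eval_polyW (head tail : E → B ⊕ I) (γ : E → ℂ) (f : B → ℂ) (q : I → ℂ) (i : I) :
    MvPolynomial.eval q (polyW head tail γ f i) =
      -((lapII ℂ head tail γ + Matrix.diagonal q).adjugate *ᵥ (lapIB ℂ head tail γ *ᵥ f)) i := by
  have h : (polyA head tail γ).map (MvPolynomial.eval q) =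
      lapII ℂ head tail γ + Matrix.diagonal q := by
    ext a b
    by_cases hab : a = b
    · subst hab; simp [polyA]
    · simp [polyA, hab]
  rw [← h, ← RingHom.mapMatrix_apply, ← RingHom.map_adjugate]
  simp [polyW, Matrix.mulVec, dotProduct]

lemma lap_mulVec (head tail : E → B ⊕ I) (γ : E → ℂ) (u : B ⊕ I → ℂ) (i : I) :
    (lap ℂ head tail γ).mulVec u (Sum.inr i) =
      (lapIB ℂ head tail γ *ᵥ (fun b => u (Sum.inl b))) i +
      (lapII ℂ head tail γ *ᵥ (fun b => u (Sum.inr b))) i := by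
  simp [Matrix.mulVec, dotProduct, lapIB, lapII, Fintype.sum_sum_type]

lemma harmonic_iff (head tail : E → B ⊕ I) (γ : E → ℂ) (q : I → ℂ) (u : B ⊕ I → ℂ) :
    Harmonic head tail γ q u ↔
      (lapII ℂ head tail γ + Matrix.diagonal q) *ᵥ (fun i => u (Sum.inr i)) =
        - (lapIB ℂ head tail γ *ᵥ (fun b => u (Sum.inl b))) := by
  rw [funext_iff, Harmonic]
  refine forall_congr' fun i => ?_
  rw [lap_mulVec, Matrix.add_mulVec, Pi.add_apply, Matrix.mulVec_diagonal, Pi.neg_apply,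
    eq_neg_iff_add_eq_zero]
  constructor <;> intro h <;> rw [← h] <;> ring

lemma harmonic_ext (head tail : E → B ⊕ I) (γ : E → ℂ) (q : I → ℂ) (f : B → ℂ) :
    Harmonic head tail γ q (Sum.elim ((lapII ℂ head tail γ + Matrix.diagonal q).det • f)
      (fun i => MvPolynomial.eval q (polyW head tail γ f i))) := by
  rw [harmonic_iff]
  simp only [Sum.elim_inl, Sum.elim_inr, eval_polyW]
  have : (fun i => -((lapII ℂ head tail γ + Matrix.diagonal q).adjugate *ᵥ
      (lapIB ℂ head tail γ *ᵥ f)) i) = -((lapII ℂ head tail γ + Matrix.diagonal q).adjugate *ᵥ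
      (lapIB ℂ head tail γ *ᵥ f)) := rfl
  rw [this, Matrix.mulVec_neg, Matrix.mulVec_mulVec, Matrix.mul_adjugate, Matrix.smul_mulVec,
    Matrix.one_mulVec]
  congr 1
  exact (Matrix.mulVec_smul _ _ _).symm

lemma eval_polyW_of_harmonic (head tail : E → B ⊕ I) (γ : E → ℂ) (q : I → ℂ) (u : B ⊕ I → ℂ)
    (hu : Harmonic head tail γ q u) (i : I) :
    MvPolynomial.eval q (polyW head tail γ (fun b => u (Sum.inl b)) i) =
      (lapII ℂ head tail γ + Matrix.diagonal q).det * u (Sum.inr i) := by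
  rw [harmonic_iff] at hu
  rw [eval_polyW, ← Pi.neg_apply, ← Matrix.mulVec_neg, ← hu, Matrix.mulVec_mulVec,
    Matrix.adjugate_mul, Matrix.smul_mulVec, Matrix.one_mulVec]
  rfl

/-- if the `(γ,q)` Dirichlet problem is well-posed for all
`q ∈ ℂ_ζ^I` and `Q(p,p) = ℂ^I` for some `p ∈ ℂ_ζ^I`, then the set of
`q ∈ ℂ_ζ^I` with `Q(q,q) ≠ ℂ^I` has Lebesgue measure zero. -/
theorem linearized_solvable_ae_schroe [Nonempty B] (head tail : E → B ⊕ I)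
    (hG : Gconn head tail) (hGI : GIconn head tail)
    (γ : E → ℂ) (hγ : ∀ e, 0 < (γ e).re) (ζ : ℝ)
    (hwell : ∀ q : I → ℂ, (∀ i, ζ < (q i).re) →
      IsUnit (lapII ℂ head tail γ + Matrix.diagonal q))
    (p : I → ℂ) (hp : ∀ i, ζ < (p i).re) (hQ : Qspace head tail γ p p = ⊤) :
    volume { q : I → ℂ | (∀ i, ζ < (q i).re) ∧ Qspace head tail γ q q ≠ ⊤ } = 0 := by
  set s : Set (I → ℂ) := { w : I → ℂ | ∃ u v : B ⊕ I → ℂ,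
    Harmonic head tail γ p u ∧ Harmonic head tail γ p v ∧
    w = fun i => u (Sum.inr i) * v (Sum.inr i) } with hs
  have hQ' : Submodule.span ℂ s = ⊤ := hQ
  obtain ⟨t, hts, htspan, htli⟩ := exists_linearIndependent ℂ s
  let b : Module.Basis t ℂ (I → ℂ) := Module.Basis.mk htli (by
    rw [Subtype.range_coe, htspan, hQ'])
  let e : I ≃ t := (Pi.basisFun ℂ I).indexEquiv b
  have hmem : ∀ j : I, ((e j : t) : I → ℂ) ∈ s := fun j => hts (e j).2
  choose u v hu hv huv using hmem
  let M : Matrix I I (MvPolynomial I ℂ) := Matrix.of fun j i =>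
    polyW head tail γ (fun b => u j (Sum.inl b)) i * polyW head tail γ (fun b => v j (Sum.inl b)) i
  have hMeval : ∀ q, MvPolynomial.eval q M.det = (M.map (MvPolynomial.eval q)).det := fun q => by
    rw [RingHom.map_det]; rfl
  have hMp : MvPolynomial.eval p M.det ≠ 0 := by
    rw [hMeval]
    set d := (lapII ℂ head tail γ + Matrix.diagonal p).det with hd
    have hd0 : d ≠ 0 := ((Matrix.isUnit_iff_isUnit_det _).1 (hwell p hp)).ne_zero
    have h1 : M.map (MvPolynomial.eval p) =
        (d * d) • (Matrix.of fun j => ((e j : t) : I → ℂ)) := by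
      ext j i
      simp only [M, Matrix.map_apply, Matrix.of_apply, map_mul, Matrix.smul_apply, smul_eq_mul]
      rw [eval_polyW_of_harmonic head tail γ p _ (hu j),
        eval_polyW_of_harmonic head tail γ p _ (hv j), huv j]
      ring
    rw [h1, Matrix.det_smul]
    refine mul_ne_zero (pow_ne_zero _ (mul_ne_zero hd0 hd0)) ?_
    refine IsUnit.ne_zero ((Matrix.isUnit_iff_isUnit_det _).1 ?_)
    rw [← Matrix.linearIndependent_rows_iff_isUnit]
    exact htli.comp e e.injective
  refine measure_mono_null ?_ (mvpoly_null M.det p hMp)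
  rintro q ⟨-, hq⟩
  by_contra hne
  apply hq
  have hne' : (M.map (MvPolynomial.eval q)).det ≠ 0 := by
    rw [← hMeval]; exact hne
  have hli : LinearIndependent ℂ (M.map (MvPolynomial.eval q)).row := by
    rw [Matrix.linearIndependent_rows_iff_isUnit, Matrix.isUnit_iff_isUnit_det]
    exact hne'.isUnit
  have htop := hli.span_eq_top_of_card_eq_finrank' (by simp)
  rw [eq_top_iff, ← htop, Qspace]
  apply Submodule.span_mono
  rintro _ ⟨j, rfl⟩
  refine ⟨_, _, harmonic_ext head tail γ q (fun b => u j (Sum.inl b)),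
    harmonic_ext head tail γ q (fun b => v j (Sum.inl b)), ?_⟩
  ext i
  simp [M, Matrix.row]

end

end DIP
end
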